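/- arXiv:1608.00994 — 8 statements merged into one kernel-verified Lean document; each statement's English description precedes it below -/
import Mathlib

section
/- (Weaker entanglement criterion.) Let ρ be a density matrix on ℂ^m ⊗ ℂ^n. If there exist vectors φ_A, ψ_A : Fin m → ℂ and φ_B, ψ_B : Fin n → ℂ such that ⟨φ_A ⊗ φ_B | ρ | φ_A ⊗ φ_B⟩ = 0 and ⟨φ_A ⊗ ψ_B | ρ | ψ_A ⊗ φ_B⟩ ≠ 0, then ρ is not separable (i.e., ρ is entangled). -/
open scoped BigOperators ComplexOrder

/-- ⟨u|A|v⟩ = Σ x y, conj (u x) * A x y * v y -/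
noncomputable def braket {n : Type*} [Fintype n] (u : n → ℂ) (A : Matrix n n ℂ)
    (v : n → ℂ) : ℂ :=
  ∑ x, ∑ y, (starRingEnd ℂ) (u x) * A x y * v y

/-- The outer product |u⟩⟨v|, with entries u x * conj (v y). -/
noncomputable def outer {n : Type*} [Fintype n] (u v : n → ℂ) : Matrix n n ℂ :=
  Matrix.of fun x y => u x * (starRingEnd ℂ) (v y)

/-- The tensor product vector (a ⊗ b) (i, k) = a i * b k. -/
noncomputable def tens {m n : ℕ} (a : Fin m → ℂ) (b : Fin n → ℂ) :
    Fin m × Fin n → ℂ :=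
  fun p => a p.1 * b p.2

/-- A product vector in ℂ^m ⊗ ℂ^n. -/
def IsProdVec {m n : ℕ} (v : Fin m × Fin n → ℂ) : Prop :=
  ∃ (a : Fin m → ℂ) (b : Fin n → ℂ), v = tens a b

/-- A state is separable if it is a finite sum of outer products of product vectors. -/
noncomputable def Separable {m n : ℕ}
    (ρ : Matrix (Fin m × Fin n) (Fin m × Fin n) ℂ) : Prop :=
  ∃ (N : ℕ) (w : Fin N → (Fin m × Fin n → ℂ)),
    (∀ j, IsProdVec (w j)) ∧ ρ = ∑ j, outer (w j) (w j)

theorem braket_sum_outer {ι κ : Type*} [Fintype ι] [Fintype κ] (w : κ → ι → ℂ) (u v : ι → ℂ) :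
    braket u (∑ j, outer (w j) (w j)) v =
      ∑ j, (star u ⬝ᵥ w j) * (starRingEnd ℂ) (star v ⬝ᵥ w j) := by
  simp only [braket, outer, Matrix.sum_apply, Matrix.of_apply, dotProduct, map_sum, map_mul,
    Pi.star_apply, RCLike.star_def, Complex.conj_conj, Finset.sum_mul_sum]
  simp only [Finset.mul_sum, Finset.sum_mul]
  symm
  rw [Finset.sum_comm]
  refine Finset.sum_congr rfl fun x _ => ?_
  rw [Finset.sum_comm]
  exact Finset.sum_congr rfl fun y _ => Finset.sum_congr rfl fun j _ => by ring

theorem star_tens_dotProduct_tens {m n : ℕ} (a c : Fin m → ℂ) (b d : Fin n → ℂ) :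
    star (tens a b) ⬝ᵥ tens c d = (star a ⬝ᵥ c) * (star b ⬝ᵥ d) := by
  simp only [dotProduct, tens, Pi.star_apply, star_mul', Finset.sum_mul_sum,
    Fintype.sum_prod_type]
  exact Finset.sum_congr rfl fun x _ => Finset.sum_congr rfl fun y _ => by ring

theorem weaker_entanglement_criterion {m n : ℕ}
    (ρ : Matrix (Fin m × Fin n) (Fin m × Fin n) ℂ)
    (hρ : ρ.PosSemidef) (htr : ρ.trace = 1)
    (φA ψA : Fin m → ℂ) (φB ψB : Fin n → ℂ)
    (h0 : braket (tens φA φB) ρ (tens φA φB) = 0)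
    (h1 : braket (tens φA ψB) ρ (tens ψA φB) ≠ 0) :
    ¬ Separable ρ := by
  rintro ⟨N, w, hw, rfl⟩
  rw [braket_sum_outer] at h0 h1
  refine h1 (Finset.sum_eq_zero fun j hj => ?_)
  obtain ⟨a, b, hab⟩ := hw j
  have hz : star (tens φA φB) ⬝ᵥ w j = 0 := by
    have h := (Finset.sum_eq_zero_iff_of_nonneg fun k _ => by
      simpa using mul_star_self_nonneg (star (tens φA φB) ⬝ᵥ w k)).1 h0 j hj
    simpa using h
  rw [hab, star_tens_dotProduct_tens] at hz
  rw [hab, star_tens_dotProduct_tens, star_tens_dotProduct_tens]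
  rcases mul_eq_zero.1 hz with h | h <;> simp [h]
end

section
/- Let V be a subspace of the finite-dimensional complex vector space (n → ℂ). Suppose a matrix ρ : Matrix n n ℂ can be written as ρ = Σ_i p_i |ψ_i⟩⟨ψ_i| where p_i ≥ 0 and every ψ_i ∈ V (a finite sum), and also as ρ = Σ_j q_j |φ_j⟩⟨φ_j| where q_j > 0 (a finite sum). Then φ_j ∈ V for every j. -/
open scoped BigOperators

/-- The quadratic form of a weighted sum of projectors at the functional `f`. -/
lemma sum_outer_quadratic_form {n ι : Type*} [Fintype n] [DecidableEq n] [Fintype ι]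
    (f : (n → ℂ) →ₗ[ℂ] ℂ) (c : ι → ℝ) (v : ι → n → ℂ) :
    ∑ x, ∑ y, f (Pi.single x 1) * (∑ i, (c i : ℂ) • outer (v i) (v i)) x y *
      (starRingEnd ℂ) (f (Pi.single y 1)) = ((∑ i, c i * Complex.normSq (f (v i)) : ℝ) : ℂ) := by
  have hf (u : n → ℂ) : f u = ∑ x, f (Pi.single x 1) * u x := by
    conv_lhs => rw [← Finset.univ_sum_single u, map_sum]
    refine Finset.sum_congr rfl fun x _ => ?_
    rw [← mul_one (u x), ← smul_eq_mul, Pi.single_smul, map_smul, smul_eq_mul, smul_eq_mul,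
      mul_one, mul_comm]
  have hnorm (u : n → ℂ) : (Complex.normSq (f u) : ℂ) = ∑ x, ∑ y,
      f (Pi.single x 1) * u x * (starRingEnd ℂ) (f (Pi.single y 1) * u y) := by
    rw [← Complex.mul_conj, hf u, map_sum, Finset.sum_mul_sum]
  push_cast
  simp only [hnorm, Matrix.sum_apply, Matrix.smul_apply, outer, Matrix.of_apply, smul_eq_mul,
    Finset.mul_sum, Finset.sum_mul, map_mul]
  simp_rw [Finset.sum_comm (s := (Finset.univ : Finset n)) (t := (Finset.univ : Finset ι))]
  refine Finset.sum_congr rfl fun i _ => Finset.sum_congr rfl fun x _ =>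
    Finset.sum_congr rfl fun y _ => ?_
  ring

theorem decompositions_lie_in_subspace {n : Type*} [Fintype n]
    (V : Submodule ℂ (n → ℂ)) (ρ : Matrix n n ℂ)
    {ι : Type*} [Fintype ι] (p : ι → ℝ) (ψ : ι → (n → ℂ))
    (hp : ∀ i, 0 ≤ p i) (hψ : ∀ i, ψ i ∈ V)
    (hdec1 : ρ = ∑ i, (p i : ℂ) • outer (ψ i) (ψ i))
    {κ : Type*} [Fintype κ] (q : κ → ℝ) (φ : κ → (n → ℂ))
    (hq : ∀ j, 0 < q j)
    (hdec2 : ρ = ∑ j, (q j : ℂ) • outer (φ j) (φ j)) :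
    ∀ j, φ j ∈ V := by
  classical
  intro j
  by_contra hj
  obtain ⟨f, hfj, hfV⟩ := Submodule.exists_le_ker_of_notMem hj
  have hsum : ∑ i, p i * Complex.normSq (f (ψ i)) = ∑ k, q k * Complex.normSq (f (φ k)) := by
    apply Complex.ofReal_injective
    rw [← sum_outer_quadratic_form, ← sum_outer_quadratic_form, ← hdec1, ← hdec2]
  have hzero : ∑ i, p i * Complex.normSq (f (ψ i)) = 0 :=
    Finset.sum_eq_zero fun i _ => by
      rw [LinearMap.mem_ker.mp (hfV (hψ i)), map_zero, mul_zero]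
  have hpos : 0 < ∑ k, q k * Complex.normSq (f (φ k)) :=
    Finset.sum_pos' (fun k _ => mul_nonneg (hq k).le (Complex.normSq_nonneg _))
      ⟨j, Finset.mem_univ j, mul_pos (hq j) (Complex.normSq_pos.mpr hfj)⟩
  exact hpos.ne (hzero.symm.trans hsum)
end

section
/- In ℂ² ⊗ ℂ³, let ψ₀ = (e₀ ⊗ f₀ + e₁ ⊗ f₁)/√2 and ψ₁ = (e₀ ⊗ f₂ + e₁ ⊗ f₀)/√2. Then no nonzero vector in the span of {ψ₀, ψ₁} is a product vector; i.e., for all α, β ∈ ℂ not both zero, α • ψ₀ + β • ψ₁ is not of the form a ⊗ b. -/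
open scoped BigOperators

/-- The standard basis vector e₀ of ℂ². -/
noncomputable def e0 : Fin 2 → ℂ := ![1, 0]

/-- The standard basis vector e₁ of ℂ². -/
noncomputable def e1 : Fin 2 → ℂ := ![0, 1]

/-- The standard basis vector f₀ of ℂ³. -/
noncomputable def f0 : Fin 3 → ℂ := ![1, 0, 0]

/-- The standard basis vector f₁ of ℂ³. -/
noncomputable def f1 : Fin 3 → ℂ := ![0, 1, 0]

/-- The standard basis vector f₂ of ℂ³. -/
noncomputable def f2 : Fin 3 → ℂ := ![0, 0, 1]

/-- ψ₀ = (|00⟩ + |11⟩)/√2 in ℂ² ⊗ ℂ³. -/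
noncomputable def ψ0 : Fin 2 × Fin 3 → ℂ :=
  (1 / (Real.sqrt 2 : ℂ)) • (tens e0 f0 + tens e1 f1)

/-- ψ₁ = (|02⟩ + |10⟩)/√2 in ℂ² ⊗ ℂ³. -/
noncomputable def ψ1 : Fin 2 × Fin 3 → ℂ :=
  (1 / (Real.sqrt 2 : ℂ)) • (tens e0 f2 + tens e1 f0)

/-- The `2 × 2` minors of a product vector vanish. -/
theorem IsProdVec.mul_eq_mul {m n : ℕ} {v : Fin m × Fin n → ℂ} (hv : IsProdVec v)
    (i j : Fin m) (k l : Fin n) : v (i, k) * v (j, l) = v (i, l) * v (j, k) := by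
  obtain ⟨a, b, rfl⟩ := hv
  simp only [tens]
  ring

theorem completely_entangled_subspace_no_product_vector
    (α β : ℂ) (h : ¬(α = 0 ∧ β = 0)) :
    ¬ IsProdVec (α • ψ0 + β • ψ1) := by
  intro hv
  have hα := hv.mul_eq_mul 0 1 0 1
  have hβ := hv.mul_eq_mul 0 1 0 2
  simp [ψ0, ψ1, tens, e0, e1, f0, f1, f2] at hα hβ
  exact h ⟨hα, hβ⟩
end

section
/- In ℂ² ⊗ ℂ³, let ψ₀ = (e₀ ⊗ f₀ + e₁ ⊗ f₁)/√2 and ψ₁ = (e₀ ⊗ f₂ + e₁ ⊗ f₀)/√2. Then every density matrix of the form ρ = a₀₀|ψ₀⟩⟨ψ₀| + a₀₁|ψ₀⟩⟨ψ₁| + a₁₀|ψ₁⟩⟨ψ₀| + a₁₁|ψ₁⟩⟨ψ₁| (with a₀₀, a₀₁, a₁₀, a₁₁ ∈ ℂ) is not separable; i.e., the span of {ψ₀, ψ₁} is a completely entangled subspace. -/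
open scoped BigOperators ComplexOrder

open Matrix in
theorem dotProduct_outer_mulVec_star {n : Type*} [Fintype n] (φ u v : n → ℂ) :
    φ ⬝ᵥ (outer u v *ᵥ star φ) = (φ ⬝ᵥ u) * starRingEnd ℂ (φ ⬝ᵥ v) := by
  simp only [dotProduct, mulVec, outer, of_apply, map_sum, map_mul, Pi.star_apply,
    starRingEnd_apply]
  rw [Finset.sum_mul_sum]
  refine Finset.sum_congr rfl fun x _ => ?_
  rw [Finset.mul_sum]
  exact Finset.sum_congr rfl fun y _ => by ring

open Matrix in
/-- If the quadratic form of `∑ j, |w j⟩⟨w j|` vanishes at `φ`, then `φ` annihilates every `w j`. -/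
theorem dotProduct_eq_zero_of_sum_outer {n ι : Type*} [Fintype n] [Fintype ι]
    (φ : n → ℂ) (w : ι → n → ℂ)
    (h : φ ⬝ᵥ ((∑ j, outer (w j) (w j)) *ᵥ star φ) = 0) (j : ι) : φ ⬝ᵥ w j = 0 := by
  rw [sum_mulVec, dotProduct_sum] at h
  simp only [dotProduct_outer_mulVec_star, Complex.mul_conj] at h
  norm_cast at h
  rw [Finset.sum_eq_zero_iff_of_nonneg fun _ _ => Complex.normSq_nonneg _] at h
  exact Complex.normSq_eq_zero.mp (h j (Finset.mem_univ j))

open Matrix in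
theorem dotProduct_ψ0 (φ : Fin 2 × Fin 3 → ℂ) :
    φ ⬝ᵥ ψ0 = (1 / (Real.sqrt 2 : ℂ)) * (φ (0, 0) + φ (1, 1)) := by
  simp [ψ0, tens, e0, e1, f0, f1, dotProduct, Fintype.sum_prod_type, Fin.sum_univ_succ]
  ring

open Matrix in
theorem dotProduct_ψ1 (φ : Fin 2 × Fin 3 → ℂ) :
    φ ⬝ᵥ ψ1 = (1 / (Real.sqrt 2 : ℂ)) * (φ (0, 2) + φ (1, 0)) := by
  simp [ψ1, tens, e0, e1, f0, f2, dotProduct, Fintype.sum_prod_type, Fin.sum_univ_succ]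
  ring

open Matrix in
/-- The span of `ψ0` and `ψ1` is completely entangled: a product vector annihilated by every
functional that annihilates `ψ0` and `ψ1` is zero. -/
theorem IsProdVec.eq_zero_of_dotProduct_eq_zero {v : Fin 2 × Fin 3 → ℂ} (hv : IsProdVec v)
    (h : ∀ φ : Fin 2 × Fin 3 → ℂ, φ ⬝ᵥ ψ0 = 0 → φ ⬝ᵥ ψ1 = 0 → φ ⬝ᵥ v = 0) : v = 0 := by
  obtain ⟨a, b, rfl⟩ := hv
  have hφ (φ : Fin 2 × Fin 3 → ℂ) (h0 : φ (0, 0) + φ (1, 1) = 0)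
      (h1 : φ (0, 2) + φ (1, 0) = 0) : φ ⬝ᵥ tens a b = 0 :=
    h φ (by rw [dotProduct_ψ0, h0, mul_zero]) (by rw [dotProduct_ψ1, h1, mul_zero])
  have h01 : a 0 * b 1 = 0 := by
    simpa [tens] using hφ (Pi.single (0, 1) 1) (by simp) (by simp)
  have h12 : a 1 * b 2 = 0 := by
    simpa [tens] using hφ (Pi.single (1, 2) 1) (by simp) (by simp)
  have h00 : a 0 * b 0 = a 1 * b 1 := by
    have := hφ (Pi.single (0, 0) 1 - Pi.single (1, 1) 1) (by simp) (by simp)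
    rwa [sub_dotProduct, single_one_dotProduct, single_one_dotProduct, sub_eq_zero] at this
  have h02 : a 0 * b 2 = a 1 * b 0 := by
    have := hφ (Pi.single (0, 2) 1 - Pi.single (1, 0) 1) (by simp) (by simp)
    rwa [sub_dotProduct, single_one_dotProduct, single_one_dotProduct, sub_eq_zero] at this
  have key : ∀ i k, a i * b k = 0 := by
    rw [Fin.forall_fin_two]
    simp only [Fin.forall_fin_succ, Fin.isValue, Fin.succ_zero_eq_one, Fin.succ_one_eq_two]
    by_cases ha : a 0 = 0 <;> simp_all
  exact funext fun p => key p.1 p.2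

theorem class_five_example (a00 a01 a10 a11 : ℂ)
    (ρ : Matrix (Fin 2 × Fin 3) (Fin 2 × Fin 3) ℂ)
    (hdef : ρ = a00 • outer ψ0 ψ0 + a01 • outer ψ0 ψ1
      + a10 • outer ψ1 ψ0 + a11 • outer ψ1 ψ1)
    (hρ : ρ.PosSemidef) (htr : ρ.trace = 1) :
    ¬ Separable ρ := by
  rintro ⟨N, w, hw, hsum⟩
  have hw0 : ∀ j, w j = 0 := fun j =>
    (hw j).eq_zero_of_dotProduct_eq_zero fun φ h0 h1 =>
      dotProduct_eq_zero_of_sum_outer φ w (by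
        rw [← hsum, hdef]
        simp [Matrix.add_mulVec, Matrix.smul_mulVec, dotProduct_outer_mulVec_star, h0, h1]) j
  have hz : ρ = 0 := by
    rw [hsum]
    ext x y
    simp [hw0, outer]
  simp [hz] at htr
end

section
/- Every 2-dimensional subspace of ℂ² ⊗ ℂ² contains a nonzero product vector. Equivalently, no 2-dimensional subspace of the space (Fin 2 × Fin 2) → ℂ is completely entangled. -/
open scoped BigOperators

/-- A vector of two qubits whose coordinate matrix has determinant zero is a product vector. -/
theorem isProdVec_of_mul_eq_mul (v : Fin 2 × Fin 2 → ℂ)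
    (h : v (0, 0) * v (1, 1) = v (0, 1) * v (1, 0)) : IsProdVec v := by
  by_cases h00 : v (0, 0) = 0
  · rw [h00, zero_mul, eq_comm, mul_eq_zero] at h
    rcases h with h01 | h10
    · refine ⟨![0, 1], ![v (1, 0), v (1, 1)], ?_⟩
      ext ⟨i, k⟩
      fin_cases i <;> fin_cases k <;> simp [tens, h00, h01]
    · refine ⟨![v (0, 1), v (1, 1)], ![0, 1], ?_⟩
      ext ⟨i, k⟩
      fin_cases i <;> fin_cases k <;> simp [tens, h00, h10]
  · refine ⟨![1, v (1, 0) / v (0, 0)], ![v (0, 0), v (0, 1)], ?_⟩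
    ext ⟨i, k⟩
    fin_cases i <;> fin_cases k <;> simp [tens, h00]
    field_simp
    linear_combination h

/-- A binary quadratic form over an algebraically closed field of characteristic not two has a
nontrivial zero. -/
theorem exists_binary_quadratic_eq_zero {K : Type*} [Field K] [IsAlgClosed K] [NeZero (2 : K)]
    (a b c : K) :
    ∃ s t : K, (s ≠ 0 ∨ t ≠ 0) ∧ a * (s * s) + b * (s * t) + c * (t * t) = 0 := by
  by_cases ha : a = 0
  · exact ⟨1, 0, Or.inl one_ne_zero, by simp [ha]⟩
  · obtain ⟨d, hd⟩ := IsAlgClosed.exists_eq_mul_self (discrim a b c)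
    obtain ⟨s, hs⟩ := exists_quadratic_eq_zero ha ⟨d, hd⟩
    exact ⟨s, 1, Or.inr one_ne_zero, by linear_combination hs⟩

theorem no_completely_entangled_two_dim_subspace_of_two_qubits
    (V : Submodule ℂ (Fin 2 × Fin 2 → ℂ)) (hV : Module.finrank ℂ V = 2) :
    ∃ v ∈ V, v ≠ 0 ∧ IsProdVec v := by
  let e := Module.finBasisOfFinrankEq ℂ V hV
  obtain ⟨s, t, hst, hzero⟩ := exists_binary_quadratic_eq_zero
    ((e 0).1 (0, 0) * (e 0).1 (1, 1) - (e 0).1 (0, 1) * (e 0).1 (1, 0))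
    ((e 0).1 (0, 0) * (e 1).1 (1, 1) + (e 1).1 (0, 0) * (e 0).1 (1, 1)
      - (e 0).1 (0, 1) * (e 1).1 (1, 0) - (e 1).1 (0, 1) * (e 0).1 (1, 0))
    ((e 1).1 (0, 0) * (e 1).1 (1, 1) - (e 1).1 (0, 1) * (e 1).1 (1, 0))
  refine ⟨(s • e 0 + t • e 1 : V), Submodule.coe_mem _, fun h => ?_, ?_⟩
  · have hs := Fintype.linearIndependent_iff.mp e.linearIndependent ![s, t]
      (by simpa [Fin.sum_univ_two] using Subtype.ext h)
    exact hst.elim (fun h' => h' (hs 0)) (fun h' => h' (hs 1))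
  · apply isProdVec_of_mul_eq_mul
    simp only [Submodule.coe_add, Submodule.coe_smul, Pi.add_apply, Pi.smul_apply, smul_eq_mul]
    linear_combination hzero
end

section
/- Let ψ_A : Fin m → ℂ be nonzero and let ψ_B, φ_B : Fin n → ℂ. Then every density matrix on ℂ^m ⊗ ℂ^n whose range is contained in the span of {ψ_A ⊗ ψ_B, ψ_A ⊗ φ_B} is separable. (If the two product vectors spanning the subspace share a common tensor factor, the whole Bloch ball is separable.) -/
open scoped BigOperators ComplexOrder

/-- A vector in the span of two product vectors with common first factor `a` is determined by its
row at any index where `a` does not vanish. -/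
theorem apply_eq_of_mem_span_tens {m n : ℕ} {a : Fin m → ℂ} {b c : Fin n → ℂ}
    {v : Fin m × Fin n → ℂ} (hv : v ∈ Submodule.span ℂ {tens a b, tens a c})
    {i₀ : Fin m} (hi₀ : a i₀ ≠ 0) (i : Fin m) (k : Fin n) :
    v (i, k) = a i / a i₀ * v (i₀, k) := by
  obtain ⟨s, t, rfl⟩ := Submodule.mem_span_pair.mp hv
  simp only [tens, Pi.add_apply, Pi.smul_apply, smul_eq_mul]
  field_simp

theorem common_factor_implies_all_separable {m n : ℕ}
    (ψA : Fin m → ℂ) (hψA : ψA ≠ 0) (ψB φB : Fin n → ℂ)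
    (ρ : Matrix (Fin m × Fin n) (Fin m × Fin n) ℂ)
    (hρ : ρ.PosSemidef) (htr : ρ.trace = 1)
    (hrange : LinearMap.range ρ.mulVecLin ≤
      Submodule.span ℂ {tens ψA ψB, tens ψA φB}) :
    Separable ρ := by
  obtain ⟨i₀, hi₀⟩ := Function.ne_iff.mp hψA
  have hrow (i : Fin m) (k : Fin n) (y : Fin m × Fin n) :
      ρ (i, k) y = ψA i / ψA i₀ * ρ (i₀, k) y := by
    have hmem := hrange (LinearMap.mem_range_self ρ.mulVecLin (Pi.single y 1))
    simpa using apply_eq_of_mem_span_tens hmem hi₀ i k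
  have hcol (x : Fin m × Fin n) (i : Fin m) (k : Fin n) :
      ρ x (i, k) = (starRingEnd ℂ) (ψA i / ψA i₀) * ρ x (i₀, k) := by
    rw [← hρ.isHermitian.apply x (i, k), hrow i k x, star_mul', hρ.isHermitian.apply]
    rfl
  obtain ⟨N, v, hv⟩ := Matrix.posSemidef_iff_eq_sum_vecMulVec.mp hρ
  refine ⟨N, fun j => tens ψA fun k => v j (i₀, k) / ψA i₀, fun j => ⟨_, _, rfl⟩, ?_⟩
  ext ⟨i, k⟩ ⟨i', k'⟩
  rw [hrow, hcol, hv]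
  simp only [Matrix.sum_apply, Matrix.vecMulVec_apply, outer, tens, Matrix.of_apply,
    Finset.mul_sum, Pi.star_apply, map_mul, map_div₀, starRingEnd_apply]
  exact Finset.sum_congr rfl fun j _ => by ring
end

section
/- In ℂ² ⊗ ℂ², let ψ = e₀ ⊗ e₀ and φ = e₁ ⊗ e₁. A density matrix of the form ρ = a₀₀|ψ⟩⟨ψ| + a₀₁|ψ⟩⟨φ| + a₁₀|φ⟩⟨ψ| + a₁₁|φ⟩⟨φ| is separable if and only if a₀₁ = 0 and a₁₀ = 0. -/
open scoped BigOperators ComplexOrder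

theorem sum_outer_self_apply_eq_zero {n : Type*} [Fintype n] {N : ℕ} {w : Fin N → n → ℂ} {x : n}
    (h : (∑ j, outer (w j) (w j)) x x = 0) (j : Fin N) : w j x = 0 := by
  simp only [Matrix.sum_apply, outer, Matrix.of_apply, Complex.mul_conj] at h
  have h' : ∑ j, Complex.normSq (w j x) = 0 := by exact_mod_cast h
  rw [Finset.sum_eq_zero_iff_of_nonneg fun _ _ => Complex.normSq_nonneg _] at h'
  exact Complex.normSq_eq_zero.mp (h' j (Finset.mem_univ j))

/-- For a separable matrix, a vanishing diagonal entry at `(i, l)` forces the coherence between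
`(i, k)` and `(j, l)` to vanish. -/
theorem Separable.apply_eq_zero {m n : ℕ} {ρ : Matrix (Fin m × Fin n) (Fin m × Fin n) ℂ}
    (hρ : Separable ρ) {i : Fin m} {l : Fin n} (h : ρ (i, l) (i, l) = 0) (j : Fin m) (k : Fin n) :
    ρ (i, k) (j, l) = 0 ∧ ρ (j, l) (i, k) = 0 := by
  obtain ⟨N, w, hw, rfl⟩ := hρ
  have key : ∀ t, w t (i, k) = 0 ∨ w t (j, l) = 0 := by
    intro t
    have h0 := sum_outer_self_apply_eq_zero h t
    obtain ⟨a, b, hab⟩ := hw t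
    simp only [hab, tens, mul_eq_zero] at h0 ⊢
    tauto
  simp only [Matrix.sum_apply, outer, Matrix.of_apply]
  constructor <;> refine Finset.sum_eq_zero fun t _ => ?_ <;> rcases key t with h | h <;> simp [h]

theorem smul_outer_tens_self {m n : ℕ} {c : ℂ} (hc : 0 ≤ c) (a : Fin m → ℂ) (b : Fin n → ℂ) :
    c • outer (tens a b) (tens a b)
      = outer (tens ((Real.sqrt c.re : ℂ) • a) b) (tens ((Real.sqrt c.re : ℂ) • a) b) := by
  have hs : (Real.sqrt c.re : ℂ) * (Real.sqrt c.re : ℂ) = c := by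
    rw [← Complex.ofReal_mul, Real.mul_self_sqrt (Complex.nonneg_iff.mp hc).1]
    exact (Complex.eq_re_of_ofReal_le hc).symm
  ext x y
  simp only [Matrix.smul_apply, outer, Matrix.of_apply, tens, Pi.smul_apply, smul_eq_mul, map_mul,
    Complex.conj_ofReal]
  conv_lhs => rw [← hs]
  ring

theorem class_two_example (a00 a01 a10 a11 : ℂ)
    (ρ : Matrix (Fin 2 × Fin 2) (Fin 2 × Fin 2) ℂ)
    (hdef : ρ = a00 • outer (tens e0 e0) (tens e0 e0)
      + a01 • outer (tens e0 e0) (tens e1 e1)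
      + a10 • outer (tens e1 e1) (tens e0 e0)
      + a11 • outer (tens e1 e1) (tens e1 e1))
    (hρ : ρ.PosSemidef) (htr : ρ.trace = 1) :
    Separable ρ ↔ a01 = 0 ∧ a10 = 0 := by
  have h00 : ρ (0, 0) (0, 0) = a00 := by simp [hdef, outer, tens, e0, e1]
  have h11 : ρ (1, 1) (1, 1) = a11 := by simp [hdef, outer, tens, e0, e1]
  have h01 : ρ (0, 0) (1, 1) = a01 := by simp [hdef, outer, tens, e0, e1]
  have h10 : ρ (1, 1) (0, 0) = a10 := by simp [hdef, outer, tens, e0, e1]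
  have hz : ρ (0, 1) (0, 1) = 0 := by simp [hdef, outer, tens, e0, e1]
  constructor
  · intro hs
    rw [← h01, ← h10]
    exact hs.apply_eq_zero hz 1 0
  · rintro ⟨rfl, rfl⟩
    have p00 : 0 ≤ a00 := h00 ▸ hρ.diag_nonneg
    have p11 : 0 ≤ a11 := h11 ▸ hρ.diag_nonneg
    refine ⟨2, ![tens ((Real.sqrt a00.re : ℂ) • e0) e0, tens ((Real.sqrt a11.re : ℂ) • e1) e1],
      ?_, ?_⟩
    · intro j
      fin_cases j
      · exact ⟨_, _, rfl⟩
      · exact ⟨_, _, rfl⟩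
    · rw [hdef, smul_outer_tens_self p00, smul_outer_tens_self p11]
      simp [Fin.sum_univ_two]
end

section
/- For three qubits, let ψ = e₀ ⊗ e₀ ⊗ e₀ (|000⟩) and φ = e₀ ⊗ e₁ ⊗ e₁ (|011⟩), viewed as vectors (Fin 2 × Fin 2 × Fin 2) → ℂ, and let ρ = a₀₀|ψ⟩⟨ψ| + a₀₁|ψ⟩⟨φ| + a₁₀|φ⟩⟨ψ| + a₁₁|φ⟩⟨φ| be a density matrix. Then ρ is separable with respect to the bipartition {1}|{2,3}; moreover, if a₁₀ ≠ 0 then ρ is entangled with respect to the bipartition {2}|{1,3} and entangled with respect to the bipartition {3}|{1,2}. -/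
open scoped BigOperators ComplexOrder

/-- Product vector across the bipartition {1}|{2,3}. -/
def IsProdVec1 (v : Fin 2 × Fin 2 × Fin 2 → ℂ) : Prop :=
  ∃ (a : Fin 2 → ℂ) (b : Fin 2 × Fin 2 → ℂ),
    ∀ i j k, v (i, j, k) = a i * b (j, k)

/-- Product vector across the bipartition {2}|{1,3}. -/
def IsProdVec2 (v : Fin 2 × Fin 2 × Fin 2 → ℂ) : Prop :=
  ∃ (a : Fin 2 → ℂ) (b : Fin 2 × Fin 2 → ℂ),
    ∀ i j k, v (i, j, k) = a j * b (i, k)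

/-- Product vector across the bipartition {3}|{1,2}. -/
def IsProdVec3 (v : Fin 2 × Fin 2 × Fin 2 → ℂ) : Prop :=
  ∃ (a : Fin 2 → ℂ) (b : Fin 2 × Fin 2 → ℂ),
    ∀ i j k, v (i, j, k) = a k * b (i, j)

/-- Separability with respect to the bipartition {1}|{2,3}. -/
noncomputable def Separable1
    (ρ : Matrix (Fin 2 × Fin 2 × Fin 2) (Fin 2 × Fin 2 × Fin 2) ℂ) : Prop :=
  ∃ (N : ℕ) (w : Fin N → (Fin 2 × Fin 2 × Fin 2 → ℂ)),
    (∀ j, IsProdVec1 (w j)) ∧ ρ = ∑ j, outer (w j) (w j)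

/-- Separability with respect to the bipartition {2}|{1,3}. -/
noncomputable def Separable2
    (ρ : Matrix (Fin 2 × Fin 2 × Fin 2) (Fin 2 × Fin 2 × Fin 2) ℂ) : Prop :=
  ∃ (N : ℕ) (w : Fin N → (Fin 2 × Fin 2 × Fin 2 → ℂ)),
    (∀ j, IsProdVec2 (w j)) ∧ ρ = ∑ j, outer (w j) (w j)

/-- Separability with respect to the bipartition {3}|{1,2}. -/
noncomputable def Separable3
    (ρ : Matrix (Fin 2 × Fin 2 × Fin 2) (Fin 2 × Fin 2 × Fin 2) ℂ) : Prop :=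
  ∃ (N : ℕ) (w : Fin N → (Fin 2 × Fin 2 × Fin 2 → ℂ)),
    (∀ j, IsProdVec3 (w j)) ∧ ρ = ∑ j, outer (w j) (w j)

/-- |000⟩. -/
noncomputable def ψ000 : Fin 2 × Fin 2 × Fin 2 → ℂ :=
  fun x => e0 x.1 * e0 x.2.1 * e0 x.2.2

/-- |011⟩. -/
noncomputable def ψ011 : Fin 2 × Fin 2 × Fin 2 → ℂ :=
  fun x => e0 x.1 * e1 x.2.1 * e1 x.2.2

theorem outer_apply {n : Type*} [Fintype n] (u v : n → ℂ) (x y : n) :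
    outer u v x y = u x * (starRingEnd ℂ) (v y) := rfl

/-- A sum of positive rank-one terms with a vanishing diagonal entry has all its vectors
vanishing there. -/
theorem eq_zero_of_sum_outer_diag_eq_zero {n ι : Type*} [Fintype n] [Fintype ι]
    (w : ι → n → ℂ) (x : n) (h : (∑ j, outer (w j) (w j)) x x = 0) (j : ι) : w j x = 0 := by
  simp only [Matrix.sum_apply, outer_apply, Complex.mul_conj] at h
  norm_cast at h
  rw [Finset.sum_eq_zero_iff_of_nonneg fun _ _ => Complex.normSq_nonneg _] at h
  exact Complex.normSq_eq_zero.mp (h j (Finset.mem_univ j))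

/-- A positive semidefinite matrix is a sum of positive rank-one terms. -/
theorem Matrix.PosSemidef.exists_eq_sum_outer {n : Type*} [Fintype n]
    {ρ : Matrix n n ℂ} (hρ : ρ.PosSemidef) :
    ∃ (N : ℕ) (w : Fin N → n → ℂ), ρ = ∑ j, outer (w j) (w j) := by
  obtain ⟨N, w, rfl⟩ := Matrix.posSemidef_iff_eq_sum_vecMulVec.mp hρ
  exact ⟨N, w, rfl⟩

theorem sphere_000_011_separability (a00 a01 a10 a11 : ℂ)
    (ρ : Matrix (Fin 2 × Fin 2 × Fin 2) (Fin 2 × Fin 2 × Fin 2) ℂ)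
    (hdef : ρ = a00 • outer ψ000 ψ000 + a01 • outer ψ000 ψ011
      + a10 • outer ψ011 ψ000 + a11 • outer ψ011 ψ011)
    (hρ : ρ.PosSemidef) (htr : ρ.trace = 1) :
    Separable1 ρ ∧ (a10 ≠ 0 → ¬ Separable2 ρ ∧ ¬ Separable3 ρ) := by
  have h1 : ∀ j k, ρ (1, j, k) (1, j, k) = 0 := fun j k => by
    simp [hdef, outer_apply, ψ000, ψ011, e0]
  have h010 : ρ (0, 1, 0) (0, 1, 0) = 0 := by
    simp [hdef, outer_apply, ψ000, ψ011, e0, e1]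
  have h001 : ρ (0, 0, 1) (0, 0, 1) = 0 := by
    simp [hdef, outer_apply, ψ000, ψ011, e0, e1]
  have ha : a10 = ρ (0, 1, 1) (0, 0, 0) := by
    simp [hdef, outer_apply, ψ000, ψ011, e0, e1]
  clear hdef
  refine ⟨?_, fun hne => ⟨?_, ?_⟩⟩
  · obtain ⟨N, w, rfl⟩ := hρ.exists_eq_sum_outer
    refine ⟨N, w, fun m => ⟨e0, fun p => w m (0, p), fun i j k => ?_⟩, rfl⟩
    fin_cases i
    · simp [e0]
    · simpa [e0] using eq_zero_of_sum_outer_diag_eq_zero w _ (h1 j k) m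
  · rintro ⟨N, w, hw, rfl⟩
    refine hne (ha.trans ?_)
    rw [Matrix.sum_apply]
    refine Finset.sum_eq_zero fun m _ => ?_
    have hz := eq_zero_of_sum_outer_diag_eq_zero w _ h010 m
    obtain ⟨a, b, hab⟩ := hw m
    rw [hab, mul_eq_zero] at hz
    rcases hz with hz | hz <;> simp [outer_apply, hab, hz]
  · rintro ⟨N, w, hw, rfl⟩
    refine hne (ha.trans ?_)
    rw [Matrix.sum_apply]
    refine Finset.sum_eq_zero fun m _ => ?_
    have hz := eq_zero_of_sum_outer_diag_eq_zero w _ h001 m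
    obtain ⟨a, b, hab⟩ := hw m
    rw [hab, mul_eq_zero] at hz
    rcases hz with hz | hz <;> simp [outer_apply, hab, hz]
end
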